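/- Let G be a k-regular simple graph on a finite vertex type V and G' a k-regular simple graph on a finite vertex type V' (the same k for both). Let M be an additive commutative monoid, upd : M → M → M an arbitrary function, and x₀ ∈ M. Define x : ℕ → V → M by x 0 v = x₀ and x (l+1) v = upd (x l v) (∑_{u ∈ N_G(v)} x l u), and define x' : ℕ → V' → M analogously on G' with the same upd and the same x₀. Then x l v = x' l w for every l ∈ ℕ, every v ∈ V, and every w ∈ V'. In particular, a message-passing network with sum aggregation, identical update function, and identical constant initial features assigns identical embeddings to all vertices of any two k-regular graphs, regardless of whether the graphs are isomorphic. -/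

import Mathlib

/-- A message-passing network with sum aggregation, identical update function and
identical constant initial features assigns identical embeddings to all vertices
of any two `k`-regular graphs. -/
theorem mpnn_regular_graphs_indistinguishable {V V' M : Type*}
    [Fintype V] [Fintype V'] [AddCommMonoid M]
    (G : SimpleGraph V) (G' : SimpleGraph V')
    [DecidableRel G.Adj] [DecidableRel G'.Adj] (k : ℕ)
    (hreg : G.IsRegularOfDegree k) (hreg' : G'.IsRegularOfDegree k)
    (upd : M → M → M) (x₀ : M)
    (x : ℕ → V → M) (x' : ℕ → V' → M)
    (hx0 : ∀ v : V, x 0 v = x₀)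
    (hxs : ∀ (l : ℕ) (v : V),
      x (l + 1) v = upd (x l v) (∑ u ∈ G.neighborFinset v, x l u))
    (hx0' : ∀ w : V', x' 0 w = x₀)
    (hxs' : ∀ (l : ℕ) (w : V'),
      x' (l + 1) w = upd (x' l w) (∑ u ∈ G'.neighborFinset w, x' l u)) :
    ∀ (l : ℕ) (v : V) (w : V'), x l v = x' l w := by
  intro l
  induction l with
  | zero => intro v w; rw [hx0, hx0']
  | succ l ih =>
    intro v w
    have h1 : ∑ u ∈ G.neighborFinset v, x l u = k • x' l w := by
      rw [Finset.sum_congr rfl (fun u _ => ih u w), Finset.sum_const,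
        SimpleGraph.card_neighborFinset_eq_degree, hreg.degree_eq v]
    have h2 : ∑ u ∈ G'.neighborFinset w, x' l u = k • x' l w := by
      rw [Finset.sum_congr rfl (fun u _ => (ih v u).symm.trans (ih v w)), Finset.sum_const,
        SimpleGraph.card_neighborFinset_eq_degree, hreg'.degree_eq w]
    rw [hxs, hxs', h1, h2, ih v w]
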